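/- Let ξ, δ ∈ ℝ and 1 ≤ p < ∞. The dual Hardy-type operator H_∞^ξ is of weak type (p,p) with respect to (ℝ₊, x^δ dx) if and only if −ξp − 1 < δ, with the inequality weakened to −ξp − 1 ≤ δ in case p = 1 and ξ ≠ 0. -/

import Mathlib

open MeasureTheory Set ENNReal
open scoped NNReal

noncomputable section

/-- The measure `x^δ dx` on `(0,∞)`. -/
def powMeasure (δ : ℝ) : Measure ℝ :=
  (volume.restrict (Ioi (0:ℝ))).withDensity (fun x => ENNReal.ofReal (x ^ δ))

/-- `f ∈ L^p(ℝ₊, x^δ dx)` for a real exponent `p`. -/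
def MemLpPow (f : ℝ → ℝ) (p δ : ℝ) : Prop :=
  AEMeasurable f (powMeasure δ) ∧
    ∫⁻ x, ENNReal.ofReal |f x| ^ p ∂(powMeasure δ) < ⊤

/-- `T` is of strong type `(p,p)` with respect to `(ℝ₊, x^δ dx)`. -/
def IsStrongType (T : (ℝ → ℝ) → (ℝ → ℝ)) (p δ : ℝ) : Prop :=
  ∃ C : ℝ≥0, ∀ f : ℝ → ℝ, MemLpPow f p δ →
    ∫⁻ x, ENNReal.ofReal |T f x| ^ p ∂(powMeasure δ) ≤
      C * ∫⁻ x, ENNReal.ofReal |f x| ^ p ∂(powMeasure δ)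

/-- `T` is of strong type `(∞,∞)`, i.e. bounded on `L^∞(ℝ₊, dx)`. -/
def IsStrongTypeInfty (T : (ℝ → ℝ) → (ℝ → ℝ)) : Prop :=
  ∃ C : ℝ≥0, ∀ f : ℝ → ℝ,
    eLpNorm (T f) ⊤ (volume.restrict (Ioi (0:ℝ))) ≤
      C * eLpNorm f ⊤ (volume.restrict (Ioi (0:ℝ)))

/-- `T` is of weak type `(p,p)` with respect to `(ℝ₊, x^δ dx)`. -/
def IsWeakType (T : (ℝ → ℝ) → (ℝ → ℝ)) (p δ : ℝ) : Prop :=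
  ∃ C : ℝ≥0, ∀ f : ℝ → ℝ, MemLpPow f p δ → ∀ l : ℝ, 0 < l →
    ENNReal.ofReal (l ^ p) * powMeasure δ {y | l < |T f y|} ≤
      C * ∫⁻ x, ENNReal.ofReal |f x| ^ p ∂(powMeasure δ)

/-- `T` is of restricted weak type `(p,p)` with respect to `(ℝ₊, x^δ dx)`:
the weak type inequality holds uniformly over indicator functions of sets of
finite `x^δ dx` measure. -/
def IsRestrictedWeakType (T : (ℝ → ℝ) → (ℝ → ℝ)) (p δ : ℝ) : Prop :=
  ∃ C : ℝ≥0, ∀ E : Set ℝ, MeasurableSet E → powMeasure δ E < ⊤ → ∀ l : ℝ, 0 < l →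
    ENNReal.ofReal (l ^ p) * powMeasure δ {y | l < |T (E.indicator 1) y|} ≤
      C * powMeasure δ E

/-- The dual Hardy-type operator `H_∞^ξ`. -/
def Hinf (ξ : ℝ) (f : ℝ → ℝ) (x : ℝ) : ℝ :=
  x ^ ξ * ∫ y in Ioi x, f y * y ^ (-ξ - 1)

theorem lintegral_powMeasure (δ : ℝ) (g : ℝ → ℝ≥0∞) :
    ∫⁻ x, g x ∂(powMeasure δ) = ∫⁻ x in Ioi (0 : ℝ), ENNReal.ofReal (x ^ δ) * g x := by
  rw [powMeasure, lintegral_withDensity_eq_lintegral_mul_non_measurable _ (by fun_prop)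
    (by simp)]
  rfl

theorem powMeasure_apply (δ : ℝ) (s : Set ℝ) :
    powMeasure δ s = ∫⁻ x in s ∩ Ioi 0, ENNReal.ofReal (x ^ δ) := by
  rw [powMeasure, withDensity_apply' _ s, Measure.restrict_restrict' measurableSet_Ioi]

theorem volume_restrict_absolutelyContinuous_powMeasure (δ : ℝ) :
    volume.restrict (Ioi (0 : ℝ)) ≪ powMeasure δ := by
  refine withDensity_absolutelyContinuous' (by fun_prop) ?_
  filter_upwards [ae_restrict_mem measurableSet_Ioi] with x hx
  simpa using Real.rpow_pos_of_pos hx δ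

theorem lintegral_Ioi_rpow {a s : ℝ} (ha : 0 < a) (hs : 0 < s) :
    ∫⁻ y in Ioi a, ENNReal.ofReal (y ^ (-s - 1)) = ENNReal.ofReal (a ^ (-s) / s) := by
  rw [← ofReal_integral_eq_lintegral_ofReal (integrableOn_Ioi_rpow_of_lt (by linarith) ha),
    integral_Ioi_rpow_of_lt (by linarith) ha]
  · congr 1
    rw [sub_add_cancel, neg_div_neg_eq]
  · filter_upwards [ae_restrict_mem measurableSet_Ioi] with y hy
    exact Real.rpow_nonneg (ha.trans hy).le _

theorem lintegral_Ioo_rpow {a s : ℝ} (ha : 0 < a) (hs : 0 < s) :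
    ∫⁻ y in Ioo 0 a, ENNReal.ofReal (y ^ (s - 1)) = ENNReal.ofReal (a ^ s / s) := by
  have hi : IntegrableOn (fun y : ℝ => y ^ (s - 1)) (Ioc 0 a) :=
    (intervalIntegrable_iff_integrableOn_Ioc_of_le ha.le).1
      (intervalIntegral.intervalIntegrable_rpow' (by linarith))
  rw [setLIntegral_congr Ioo_ae_eq_Ioc, ← ofReal_integral_eq_lintegral_ofReal hi,
    ← intervalIntegral.integral_of_le ha.le, integral_rpow (Or.inl (by linarith))]
  · simp [Real.zero_rpow hs.ne']
  · filter_upwards [ae_restrict_mem measurableSet_Ioc] with y hy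
    exact Real.rpow_nonneg hy.1.le _

theorem rpow_lintegral_le_lintegral_rpow {α : Type*} [MeasurableSpace α] {ν : Measure α}
    [IsProbabilityMeasure ν] {p : ℝ} (hp : 1 ≤ p) {h : α → ℝ≥0∞} (hh : AEMeasurable h ν) :
    (∫⁻ y, h y ∂ν) ^ p ≤ ∫⁻ y, h y ^ p ∂ν := by
  have key := eLpNorm'_le_eLpNorm'_of_exponent_le one_pos hp ν hh.aestronglyMeasurable
  have hp0 : 0 < p := by linarith
  simp only [eLpNorm', enorm_eq_self, ENNReal.rpow_one, div_one] at key
  calc _ ≤ ((∫⁻ y, h y ^ p ∂ν) ^ (1 / p)) ^ p := by gcongr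
    _ = _ := by rw [← ENNReal.rpow_mul, one_div_mul_cancel hp0.ne', ENNReal.rpow_one]

theorem ofReal_abs_Hinf_le (ξ : ℝ) (f : ℝ → ℝ) {x : ℝ} (hx : 0 < x) :
    ENNReal.ofReal |Hinf ξ f x| ≤ ENNReal.ofReal (x ^ ξ) *
      ∫⁻ y in Ioi x, ENNReal.ofReal |f y| * ENNReal.ofReal (y ^ (-ξ - 1)) := by
  rw [Hinf, abs_mul, ENNReal.ofReal_mul (abs_nonneg _), abs_of_pos (Real.rpow_pos_of_pos hx ξ)]
  gcongr
  rw [← Real.norm_eq_abs, ofReal_norm]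
  refine (enorm_integral_le_lintegral_enorm _).trans_eq ?_
  refine setLIntegral_congr_fun measurableSet_Ioi fun y hy => ?_
  have hy0 : 0 < y := hx.trans hy
  rw [enorm_mul, Real.enorm_eq_ofReal_abs, Real.enorm_of_nonneg (Real.rpow_nonneg hy0.le _)]

/-- Jensen's inequality against the probability density `ε x^ε y^(-ε-1)` on `(x, ∞)`. -/
theorem rpow_hardy_le {p ε : ℝ} (ξ : ℝ) (hp : 1 ≤ p) (hε : 0 < ε) {G : ℝ → ℝ≥0∞}
    (hG : Measurable G) {x : ℝ} (hx : 0 < x) :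
    (ENNReal.ofReal (x ^ ξ) * ∫⁻ y in Ioi x, G y * ENNReal.ofReal (y ^ (-ξ - 1))) ^ p ≤
      ENNReal.ofReal (ε⁻¹ ^ p * ε * x ^ ((ξ - ε) * p + ε)) *
        ∫⁻ y in Ioi x, G y ^ p * ENNReal.ofReal (y ^ ((ε - ξ) * p - ε - 1)) := by
  set w : ℝ → ℝ≥0∞ := fun y => ENNReal.ofReal (ε * x ^ ε * y ^ (-ε - 1)) with hw
  have hwm : Measurable w := by fun_prop
  set ν := (volume.restrict (Ioi x)).withDensity w with hν
  have hc : 0 ≤ ε * x ^ ε := by positivity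
  have : IsProbabilityMeasure ν := by
    constructor
    rw [hν, withDensity_apply _ MeasurableSet.univ, Measure.restrict_univ]
    simp_rw [hw, ENNReal.ofReal_mul hc]
    rw [lintegral_const_mul _ (by fun_prop), lintegral_Ioi_rpow hx hε, ← ENNReal.ofReal_mul hc,
      Real.rpow_neg hx.le, ENNReal.ofReal_eq_one]
    have := Real.rpow_pos_of_pos hx ε
    field_simp
  have hden (g : ℝ → ℝ≥0∞) : ∫⁻ y, g y ∂ν = ∫⁻ y in Ioi x, w y * g y := by
    rw [hν, lintegral_withDensity_eq_lintegral_mul_non_measurable _ hwm (by simp [hw])]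
    rfl
  have hJ := rpow_lintegral_le_lintegral_rpow (ν := ν) hp
    (h := fun y => G y * ENNReal.ofReal (ε⁻¹ * x ^ (ξ - ε) * y ^ (ε - ξ)))
    (by fun_prop)
  rw [hden, hden] at hJ
  convert hJ using 1
  · congr 1
    rw [← lintegral_const_mul _ (by fun_prop)]
    refine setLIntegral_congr_fun measurableSet_Ioi fun y hy => ?_
    have hy0 : 0 < y := hx.trans hy
    simp only [hw]
    rw [mul_left_comm, mul_left_comm (ENNReal.ofReal (ε * _ * _)),
      ← ENNReal.ofReal_mul (by positivity), ← ENNReal.ofReal_mul (by positivity)]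
    congr 2
    rw [show ε * x ^ ε * y ^ (-ε - 1) * (ε⁻¹ * x ^ (ξ - ε) * y ^ (ε - ξ)) =
      (ε * ε⁻¹) * (x ^ ε * x ^ (ξ - ε)) * (y ^ (-ε - 1) * y ^ (ε - ξ)) by ring,
      ← Real.rpow_add hx, ← Real.rpow_add hy0, mul_inv_cancel₀ hε.ne']
    ring_nf
  · rw [← lintegral_const_mul _ (by fun_prop)]
    refine setLIntegral_congr_fun measurableSet_Ioi fun y hy => ?_
    have hy0 : 0 < y := hx.trans hy
    simp only [hw]
    rw [ENNReal.mul_rpow_of_nonneg _ _ (by linarith), mul_left_comm,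
      mul_left_comm (ENNReal.ofReal (ε * _ * _)),
      ENNReal.ofReal_rpow_of_nonneg (by positivity) (by linarith),
      ← ENNReal.ofReal_mul (by positivity), ← ENNReal.ofReal_mul (by positivity)]
    congr 2
    rw [Real.mul_rpow (by positivity) (by positivity),
      Real.mul_rpow (by positivity) (by positivity), ← Real.rpow_mul hx.le, ← Real.rpow_mul hy0.le,
      show ε * x ^ ε * y ^ (-ε - 1) * (ε⁻¹ ^ p * x ^ ((ξ - ε) * p) * y ^ ((ε - ξ) * p)) =
      ε⁻¹ ^ p * ε * (x ^ ((ξ - ε) * p) * x ^ ε) * (y ^ (-ε - 1) * y ^ ((ε - ξ) * p)) by ring,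
      ← Real.rpow_add hx, ← Real.rpow_add hy0]
    ring_nf

theorem lintegral_Ioi_lintegral_Ioi_rpow {ε : ℝ} (hε : 0 < ε) {F : ℝ → ℝ≥0∞} (hF : Measurable F) :
    ∫⁻ x in Ioi (0 : ℝ), ENNReal.ofReal (x ^ (ε - 1)) * ∫⁻ y in Ioi x, F y =
      ∫⁻ y in Ioi (0 : ℝ), ENNReal.ofReal (y ^ ε / ε) * F y := by
  have hT : MeasurableSet {q : ℝ × ℝ | 0 < q.1 ∧ q.1 < q.2} :=
    (measurableSet_lt measurable_const measurable_fst).inter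
      (measurableSet_lt measurable_fst measurable_snd)
  set K : ℝ → ℝ → ℝ≥0∞ := fun x y => {q : ℝ × ℝ | 0 < q.1 ∧ q.1 < q.2}.indicator
    (fun q => ENNReal.ofReal (q.1 ^ (ε - 1)) * F q.2) (x, y) with hK
  have hKm : Measurable (Function.uncurry K) :=
    (Measurable.indicator (by fun_prop) hT : Measurable _)
  calc _ = ∫⁻ x, ∫⁻ y, K x y := by
        rw [← lintegral_indicator measurableSet_Ioi]
        refine lintegral_congr fun x => ?_
        by_cases hx : 0 < x
        · rw [indicator_of_mem (by exact hx), ← lintegral_const_mul _ hF,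
            ← lintegral_indicator measurableSet_Ioi]
          refine lintegral_congr fun y => ?_
          simp [hK, indicator, hx]
        · simp [hK, indicator, hx]
    _ = ∫⁻ y, ∫⁻ x, K x y := lintegral_lintegral_swap hKm.aemeasurable
    _ = _ := by
        rw [← lintegral_indicator measurableSet_Ioi]
        refine lintegral_congr fun y => ?_
        by_cases hy : 0 < y
        · rw [indicator_of_mem (by exact hy), ← lintegral_Ioo_rpow hy hε,
            ← lintegral_mul_const _ (by fun_prop), ← lintegral_indicator measurableSet_Ioo]
          refine lintegral_congr fun x => ?_
          simp [hK, indicator]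
        · rw [indicator_of_notMem (by exact hy)]
          refine (lintegral_congr fun x => ?_).trans lintegral_zero
          simp only [hK, indicator, mem_ofPred_eq]
          exact if_neg fun h => hy (h.1.trans h.2)

theorem isWeakType_Hinf_of_lt {ξ δ p : ℝ} (hp : 1 ≤ p) (h : -ξ * p - 1 < δ) :
    IsWeakType (Hinf ξ) p δ := by
  have hp0 : 0 < p := by linarith
  obtain ⟨ε, hε, rfl⟩ : ∃ ε, 0 < ε ∧ δ = (ε - ξ) * p - 1 :=
    ⟨(δ + ξ * p + 1) / p, div_pos (by linarith) hp0, by field_simp; ring⟩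
  refine ⟨(ε⁻¹ ^ p).toNNReal, fun f hf l hl => ?_⟩
  have hfm : AEMeasurable f (volume.restrict (Ioi 0)) :=
    hf.1.mono_ac (volume_restrict_absolutelyContinuous_powMeasure _)
  set g := hfm.mk f
  have hgm : Measurable g := hfm.measurable_mk
  set G : ℝ → ℝ≥0∞ := fun y => ENNReal.ofReal |g y| with hG
  have hGm : Measurable G := by
    have := measurable_norm.comp hgm
    exact ENNReal.measurable_ofReal.comp this
  have hfG : (fun y => ENNReal.ofReal |f y|) =ᵐ[volume.restrict (Ioi 0)] G := by
    filter_upwards [hfm.ae_eq_mk] with y hy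
    rw [hy]
  set F : ℝ → ℝ≥0∞ := fun y => G y ^ p * ENNReal.ofReal (y ^ ((ε - ξ) * p - ε - 1)) with hF
  have hFm : Measurable F := by fun_prop
  set M : ℝ → ℝ≥0∞ := fun x => ENNReal.ofReal (ε⁻¹ ^ p * ε * x ^ ((ξ - ε) * p + ε)) *
    ∫⁻ y in Ioi x, F y with hM
  have hMm : Measurable M := by
    have : Measurable fun x => ∫⁻ y in Ioi x, F y :=
      Antitone.measurable fun a b hab => lintegral_mono_set (Ioi_subset_Ioi hab)
    fun_prop
  have hbd : ∀ x, 0 < x → ENNReal.ofReal |Hinf ξ f x| ^ p ≤ M x := fun x hx => by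
    refine le_trans ?_ (rpow_hardy_le ξ hp hε hGm hx)
    gcongr
    refine (ofReal_abs_Hinf_le ξ f hx).trans_eq ?_
    congr 1
    refine lintegral_congr_ae ?_
    filter_upwards [ae_restrict_of_ae_restrict_of_subset (Ioi_subset_Ioi hx.le) hfG] with y hy
    rw [hy]
  calc _ ≤ ENNReal.ofReal (l ^ p) *
        powMeasure ((ε - ξ) * p - 1) {x | ENNReal.ofReal (l ^ p) ≤ M x} := by
        gcongr 1
        rw [powMeasure_apply, powMeasure_apply]
        refine lintegral_mono_set fun x hx => ⟨?_, hx.2⟩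
        refine le_trans ?_ (hbd x hx.2)
        rw [← ENNReal.ofReal_rpow_of_nonneg hl.le hp0.le]
        gcongr
        exact hx.1.le
    _ ≤ ∫⁻ x, M x ∂(powMeasure ((ε - ξ) * p - 1)) := mul_meas_ge_le_lintegral hMm _
    _ = ∫⁻ x in Ioi (0 : ℝ), ENNReal.ofReal (ε⁻¹ ^ p * ε) *
          (ENNReal.ofReal (x ^ (ε - 1)) * ∫⁻ y in Ioi x, F y) := by
        rw [lintegral_powMeasure]
        refine setLIntegral_congr_fun measurableSet_Ioi fun x hx => ?_
        have hx0 : 0 < x := hx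
        simp only [hM]
        rw [← mul_assoc, ← mul_assoc, ← ENNReal.ofReal_mul (by positivity),
          ← ENNReal.ofReal_mul (by positivity), mul_left_comm, ← Real.rpow_add hx0]
        ring_nf
    _ = ENNReal.ofReal (ε⁻¹ ^ p * ε) *
          ∫⁻ y in Ioi (0 : ℝ), ENNReal.ofReal (y ^ ε / ε) * F y := by
        rw [lintegral_const_mul' _ _ ENNReal.ofReal_ne_top, lintegral_Ioi_lintegral_Ioi_rpow hε hFm]
    _ = _ := by
        rw [← lintegral_const_mul' _ _ ENNReal.ofReal_ne_top, lintegral_powMeasure,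
          ← lintegral_const_mul' _ _ ENNReal.coe_ne_top]
        refine lintegral_congr_ae ?_
        filter_upwards [hfG, ae_restrict_mem measurableSet_Ioi] with y hy hy0
        have hy0 : 0 < y := hy0
        change _ = ENNReal.ofReal (ε⁻¹ ^ p) * _
        rw [hy]
        simp only [hF]
        rw [mul_comm (G y ^ p), ← mul_assoc, ← mul_assoc, ← mul_assoc,
          ← ENNReal.ofReal_mul (by positivity), ← ENNReal.ofReal_mul (by positivity),
          ← ENNReal.ofReal_mul (by positivity)]
        congr 2
        rw [show ε⁻¹ ^ p * ε * (y ^ ε / ε) * y ^ ((ε - ξ) * p - ε - 1) =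
          ε⁻¹ ^ p * (ε / ε) * (y ^ ε * y ^ ((ε - ξ) * p - ε - 1)) by ring, ← Real.rpow_add hy0,
          div_self hε.ne']
        ring_nf

theorem powMeasure_setOf_lt_rpow_mul {ξ t : ℝ} (hξ : ξ ≠ 0) (ht : 0 < t) :
    powMeasure (-ξ - 1) {x | t < x ^ ξ} ≤ ENNReal.ofReal (t⁻¹ / |ξ|) := by
  have ha : 0 < t ^ ξ⁻¹ := by positivity
  have hat : (t ^ ξ⁻¹) ^ (-ξ) = t⁻¹ := by
    rw [← Real.rpow_mul ht.le, mul_neg, inv_mul_cancel₀ hξ, Real.rpow_neg_one]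
  have hat' : (t ^ ξ⁻¹) ^ ξ = t := by
    rw [← Real.rpow_mul ht.le, inv_mul_cancel₀ hξ, Real.rpow_one]
  rw [powMeasure_apply]
  rcases hξ.lt_or_gt with h | h
  · rw [abs_of_neg h, ← hat, ← lintegral_Ioo_rpow ha (neg_pos.2 h)]
    refine lintegral_mono_set fun x hx => ⟨hx.2, ?_⟩
    by_contra! hle
    have := Real.rpow_le_rpow_of_nonpos ha hle h.le
    rw [hat'] at this
    exact absurd hx.1 (not_lt.2 this)
  · rw [abs_of_pos h, ← hat, ← lintegral_Ioi_rpow ha h]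
    refine lintegral_mono_set fun x hx => ?_
    by_contra! hle
    have := Real.rpow_le_rpow (le_of_lt hx.2) (not_lt.1 hle) h.le
    rw [hat'] at this
    exact absurd hx.1 (not_lt.2 this)

theorem isWeakType_Hinf_one {ξ : ℝ} (hξ : ξ ≠ 0) : IsWeakType (Hinf ξ) 1 (-ξ - 1) := by
  refine ⟨(1 / |ξ|).toNNReal, fun f hf l hl => ?_⟩
  have hfin := hf.2
  simp only [ENNReal.rpow_one, Real.rpow_one] at hfin ⊢
  set A := ∫⁻ x, ENNReal.ofReal |f x| ∂(powMeasure (-ξ - 1)) with hA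
  have hbd : ∀ x, 0 < x → |Hinf ξ f x| ≤ x ^ ξ * A.toReal := fun x hx => by
    rw [← ENNReal.ofReal_le_ofReal_iff (by positivity), ENNReal.ofReal_mul (by positivity),
      ENNReal.ofReal_toReal hfin.ne]
    refine (ofReal_abs_Hinf_le ξ f hx).trans ?_
    gcongr
    rw [hA, lintegral_powMeasure]
    simp_rw [mul_comm (ENNReal.ofReal |_|)]
    exact lintegral_mono_set (Ioi_subset_Ioi hx.le)
  have hmono (s : Set ℝ) (hs : ∀ x, 0 < x → l < x ^ ξ * A.toReal → x ∈ s) :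
      powMeasure (-ξ - 1) {y | l < |Hinf ξ f y|} ≤ powMeasure (-ξ - 1) s := by
    rw [powMeasure_apply, powMeasure_apply]
    exact lintegral_mono_set fun x hx => ⟨hs x hx.2 (lt_of_lt_of_le hx.1 (hbd x hx.2)), hx.2⟩
  rcases (ENNReal.toReal_nonneg (a := A)).eq_or_lt' with h0 | h0
  · have := hmono ∅ fun x _ hx => by rw [h0, mul_zero] at hx; exact (hl.not_gt hx).elim
    rw [measure_empty, nonpos_iff_eq_zero] at this
    simp [this]
  · calc _ ≤ ENNReal.ofReal l * powMeasure (-ξ - 1) {x | l / A.toReal < x ^ ξ} := by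
          gcongr 1
          exact hmono _ fun x _ hx => (div_lt_iff₀ h0).2 hx
      _ ≤ ENNReal.ofReal l * ENNReal.ofReal ((l / A.toReal)⁻¹ / |ξ|) := by
          gcongr
          exact powMeasure_setOf_lt_rpow_mul hξ (by positivity)
      _ = ENNReal.ofReal (1 / |ξ|) * ENNReal.ofReal A.toReal := by
          rw [← ENNReal.ofReal_mul hl.le, ← ENNReal.ofReal_mul (by positivity)]
          congr 1
          field_simp
      _ = _ := by rw [ENNReal.ofReal_toReal hfin.ne]; rfl

theorem Hinf_indicator_rpow (ξ : ℝ) {L x : ℝ} (hL : 0 ≤ L) (hx1 : x ≤ 1) :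
    Hinf ξ ((Ioc 1 (Real.exp L)).indicator (fun y => y ^ ξ)) x = x ^ ξ * L := by
  have hN : 1 ≤ Real.exp L := Real.one_le_exp hL
  rw [Hinf]
  congr 1
  have h1 : ∀ y, (Ioc 1 (Real.exp L)).indicator (fun y => y ^ ξ) y * y ^ (-ξ - 1) =
      (Ioc 1 (Real.exp L)).indicator (fun y => y⁻¹) y := fun y => by
    by_cases hy : y ∈ Ioc 1 (Real.exp L)
    · rw [indicator_of_mem hy, indicator_of_mem hy, ← Real.rpow_add (one_pos.trans hy.1),
        ← Real.rpow_neg_one]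
      ring_nf
    · simp [indicator_of_notMem hy]
  simp_rw [h1]
  rw [setIntegral_indicator measurableSet_Ioc,
    inter_eq_self_of_subset_right ((Ioc_subset_Ioi_self).trans (Ioi_subset_Ioi hx1)),
    ← intervalIntegral.integral_of_le hN, integral_inv_of_pos one_pos (by positivity)]
  simp

theorem lintegral_indicator_rpow (ξ δ : ℝ) {p : ℝ} (hp : 0 < p) (s : Set ℝ) (hs : MeasurableSet s)
    (hs0 : s ⊆ Ioi 0) :
    ∫⁻ x, ENNReal.ofReal |s.indicator (fun y => y ^ ξ) x| ^ p ∂(powMeasure δ) =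
      ∫⁻ y in s, ENNReal.ofReal (y ^ (ξ * p + δ)) := by
  rw [lintegral_powMeasure, ← lintegral_indicator measurableSet_Ioi, ← lintegral_indicator hs]
  refine lintegral_congr fun y => ?_
  by_cases hy : y ∈ s
  · have hy0 : 0 < y := hs0 hy
    rw [indicator_of_mem (hs0 hy), indicator_of_mem hy, indicator_of_mem hy,
      abs_of_pos (by positivity), ENNReal.ofReal_rpow_of_nonneg (by positivity) hp.le,
      ← ENNReal.ofReal_mul (by positivity), ← Real.rpow_mul hy0.le, ← Real.rpow_add hy0, add_comm]
  · simp [indicator, hy, hp]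

theorem lintegral_Ioc_inv {L : ℝ} (hL : 0 ≤ L) :
    ∫⁻ y in Ioc 1 (Real.exp L), ENNReal.ofReal y⁻¹ = ENNReal.ofReal L := by
  have hN : 1 ≤ Real.exp L := Real.one_le_exp hL
  have hi : IntegrableOn (fun y : ℝ => y⁻¹) (Ioc 1 (Real.exp L)) :=
    (intervalIntegrable_iff_integrableOn_Ioc_of_le hN).1
      (intervalIntegrable_inv_iff.2 (Or.inr (by simp [uIcc_of_le hN])))
  rw [← ofReal_integral_eq_lintegral_ofReal hi, ← intervalIntegral.integral_of_le hN,
    integral_inv_of_pos one_pos (by positivity)]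
  · simp
  · filter_upwards [ae_restrict_mem measurableSet_Ioc] with y hy
    exact inv_nonneg.2 (one_pos.trans hy.1).le

theorem lintegral_Ioc_rpow_le {κ : ℝ} (hκ : κ ≤ 0) {L : ℝ} (hL : 0 ≤ L) :
    ∫⁻ y in Ioc 1 (Real.exp L), ENNReal.ofReal (y ^ (κ - 1)) ≤ ENNReal.ofReal L := by
  rw [← lintegral_Ioc_inv hL]
  refine setLIntegral_mono (by fun_prop) fun y hy => ?_
  rw [← Real.rpow_neg_one y]
  exact ENNReal.ofReal_le_ofReal (Real.rpow_le_rpow_of_exponent_le hy.1.le (by linarith))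

/-- Testing the weak type inequality on `y^ξ` restricted to `(1, e^L]`. -/
theorem IsWeakType.exists_test_bound {ξ δ p : ℝ} (hp : 1 ≤ p) (h : δ + ξ * p + 1 ≤ 0)
    (hw : IsWeakType (Hinf ξ) p δ) :
    ∃ C : ℝ≥0, ∀ L, 0 < L → ∀ c, 0 < c →
      ENNReal.ofReal ((c * L) ^ p) * powMeasure δ {x | x ≤ 1 ∧ c < x ^ ξ} ≤
        C * ∫⁻ y in Ioc 1 (Real.exp L), ENNReal.ofReal (y ^ ((δ + ξ * p + 1) - 1)) := by
  have hp0 : 0 < p := by linarith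
  obtain ⟨C, hC⟩ := hw
  refine ⟨C, fun L hL c hc => ?_⟩
  have hI := lintegral_indicator_rpow ξ δ hp0 (Ioc 1 (Real.exp L)) measurableSet_Ioc
    fun y hy => one_pos.trans hy.1
  rw [show ξ * p + δ = (δ + ξ * p + 1) - 1 by ring] at hI
  have := hC ((Ioc 1 (Real.exp L)).indicator (fun y => y ^ ξ)) ⟨?_, ?_⟩ (c * L) (by positivity)
  · rw [hI] at this
    refine le_trans ?_ this
    refine mul_le_mul_right (measure_mono ?_) _
    rintro x ⟨hx, hcx⟩
    rw [mem_ofPred_eq, Hinf_indicator_rpow ξ hL.le hx]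
    exact lt_of_lt_of_le (by gcongr) (le_abs_self _)
  · exact (Measurable.indicator (by fun_prop) measurableSet_Ioc).aemeasurable
  · rw [hI]
    exact (lintegral_Ioc_rpow_le h hL.le).trans_lt ENNReal.ofReal_lt_top

theorem exists_powMeasure_setOf_lt_rpow_ne_zero (ξ δ : ℝ) :
    ∃ c, 0 < c ∧ powMeasure δ {x | x ≤ 1 ∧ c < x ^ ξ} ≠ 0 := by
  obtain ⟨c, hc, hcx⟩ : ∃ c : ℝ, 0 < c ∧ ∀ x ∈ Ioo (1 / 2 : ℝ) 1, c < x ^ ξ := by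
    refine ⟨min ((1 / 2) ^ ξ) 1 / 2, by positivity, fun x hx => ?_⟩
    have hx0 : 0 < x := by linarith [hx.1]
    have hlt : min ((1 / 2 : ℝ) ^ ξ) 1 / 2 < min ((1 / 2) ^ ξ) 1 := half_lt_self (by positivity)
    refine hlt.trans_le ?_
    rcases le_total 0 ξ with h | h
    · exact (min_le_left _ _).trans (Real.rpow_le_rpow (by norm_num) hx.1.le h)
    · exact (min_le_right _ _).trans (Real.one_le_rpow_of_pos_of_le_one_of_nonpos hx0 hx.2.le h)
  refine ⟨c, hc, fun h0 => ?_⟩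
  have hsub : Ioo (1 / 2 : ℝ) 1 ⊆ {x | x ≤ 1 ∧ c < x ^ ξ} := fun x hx => ⟨hx.2.le, hcx x hx⟩
  have h1 := volume_restrict_absolutelyContinuous_powMeasure δ (measure_mono_null hsub h0)
  rw [Measure.restrict_apply measurableSet_Ioo, inter_eq_self_of_subset_left
    (Ioo_subset_Ioi_self.trans (Ioi_subset_Ioi (by norm_num)))] at h1
  norm_num at h1

theorem not_isWeakType_Hinf_of_rpow_bound {ξ δ p B r : ℝ} (hp : 1 ≤ p) (hr : r < p)
    (h : δ + ξ * p + 1 ≤ 0)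
    (hB : ∀ L, 0 < L → ∫⁻ y in Ioc 1 (Real.exp L), ENNReal.ofReal (y ^ ((δ + ξ * p + 1) - 1)) ≤
      ENNReal.ofReal (B * L ^ r)) : ¬ IsWeakType (Hinf ξ) p δ := by
  intro hw
  obtain ⟨C, hC⟩ := hw.exists_test_bound hp h
  obtain ⟨c, hc, hm⟩ := exists_powMeasure_setOf_lt_rpow_ne_zero ξ δ
  set m := powMeasure δ {x | x ≤ 1 ∧ c < x ^ ξ}
  have hD : (C : ℝ≥0∞) / m ≠ ⊤ := ENNReal.div_ne_top ENNReal.coe_ne_top hm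
  have key : ∀ L, 0 < L → L ^ (p - r) ≤ ((C : ℝ≥0∞) / m).toReal * |B| / c ^ p := fun L hL => by
    have h1 : ENNReal.ofReal ((c * L) ^ p) ≤ C / m * ENNReal.ofReal (|B| * L ^ r) := by
      rw [← ENNReal.mul_div_right_comm, ENNReal.le_div_iff_mul_le (Or.inl hm)
        (Or.inr (ENNReal.mul_ne_top ENNReal.coe_ne_top ENNReal.ofReal_ne_top))]
      refine (hC L hL c hc).trans ?_
      gcongr
      refine (hB L hL).trans (ENNReal.ofReal_le_ofReal ?_)
      gcongr
      exact le_abs_self B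
    rw [← ENNReal.ofReal_toReal hD, ← ENNReal.ofReal_mul ENNReal.toReal_nonneg,
      ENNReal.ofReal_le_ofReal_iff (by positivity), Real.mul_rpow hc.le hL.le] at h1
    rw [le_div_iff₀ (by positivity), Real.rpow_sub hL, div_mul_eq_mul_div,
      div_le_iff₀ (by positivity)]
    linarith
  obtain ⟨L, hL, hL0⟩ := (((tendsto_rpow_atTop (sub_pos.2 hr)).eventually_gt_atTop
    (((C : ℝ≥0∞) / m).toReal * |B| / c ^ p)).and (Filter.eventually_gt_atTop 0)).exists
  exact absurd (key L hL0) (not_le.2 hL)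

theorem powMeasure_neg_one_setOf_lt_rpow_zero : powMeasure (-1) {x | x ≤ 1 ∧ 1 / 2 < x ^ (0 : ℝ)} = ⊤ := by
  have : {x : ℝ | x ≤ 1 ∧ 1 / 2 < x ^ (0 : ℝ)} = Iic 1 := by
    ext x; norm_num
  rw [this, powMeasure_apply, Iic_inter_Ioi]
  by_contra hne
  have hi : IntegrableOn (fun y : ℝ => y ^ (-1 : ℝ)) (Ioc 0 1) := by
    refine ⟨by fun_prop, ?_⟩
    rw [hasFiniteIntegral_iff_ofReal]
    · exact lt_top_iff_ne_top.2 hne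
    · filter_upwards [ae_restrict_mem measurableSet_Ioc] with y hy
      exact Real.rpow_nonneg hy.1.le _
  rw [← intervalIntegrable_iff_integrableOn_Ioc_of_le zero_le_one] at hi
  simp [Real.rpow_neg_one, intervalIntegrable_inv_iff] at hi

theorem not_isWeakType_Hinf_zero : ¬ IsWeakType (Hinf 0) 1 (-1) := by
  intro hw
  obtain ⟨C, hC⟩ := hw.exists_test_bound le_rfl (by norm_num)
  have h1 := hC 1 one_pos (1 / 2) (by norm_num)
  rw [powMeasure_neg_one_setOf_lt_rpow_zero, ENNReal.mul_top (by simp), top_le_iff] at h1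
  exact ENNReal.mul_ne_top ENNReal.coe_ne_top (ne_top_of_le_ne_top ENNReal.ofReal_ne_top
    (lintegral_Ioc_rpow_le (by norm_num) zero_le_one)) h1

theorem not_isWeakType_Hinf_of_one_lt {ξ δ p : ℝ} (hp : 1 < p) (h : δ ≤ -ξ * p - 1) :
    ¬ IsWeakType (Hinf ξ) p δ :=
  not_isWeakType_Hinf_of_rpow_bound (B := 1) hp.le hp (by linarith) fun L hL => by
    simpa using lintegral_Ioc_rpow_le (κ := δ + ξ * p + 1) (by linarith) hL.le

theorem not_isWeakType_Hinf_of_lt {ξ δ p : ℝ} (hp : 1 ≤ p) (h : δ < -ξ * p - 1) :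
    ¬ IsWeakType (Hinf ξ) p δ := by
  have hκ : 0 < -(δ + ξ * p + 1) := by linarith
  refine not_isWeakType_Hinf_of_rpow_bound (B := 1 / -(δ + ξ * p + 1)) (r := 0) hp (by linarith)
    (by linarith) fun L hL => ?_
  have := lintegral_Ioi_rpow one_pos hκ
  rw [neg_neg, Real.one_rpow] at this
  rw [Real.rpow_zero, mul_one]
  exact (lintegral_mono_set Ioc_subset_Ioi_self).trans_eq this

theorem stmt4 (ξ δ p : ℝ) (hp : 1 ≤ p) :
    IsWeakType (Hinf ξ) p δ ↔
      ((p = 1 ∧ ξ ≠ 0) → -ξ * p - 1 ≤ δ) ∧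
      (¬ (p = 1 ∧ ξ ≠ 0) → -ξ * p - 1 < δ) := by
  constructor
  · intro hw
    refine ⟨fun _ => ?_, fun hne => ?_⟩
    · by_contra! hlt
      exact not_isWeakType_Hinf_of_lt hp hlt hw
    · by_contra! hle
      rcases hp.eq_or_lt with rfl | hp1
      · rcases hle.eq_or_lt with rfl | hlt
        · obtain rfl : ξ = 0 := by simpa using hne
          exact not_isWeakType_Hinf_zero (by simpa using hw)
        · exact not_isWeakType_Hinf_of_lt le_rfl hlt hw
      · exact not_isWeakType_Hinf_of_one_lt hp1 hle hw
  · rintro ⟨h1, h2⟩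
    by_cases hc : p = 1 ∧ ξ ≠ 0
    · rcases (h1 hc).eq_or_lt with rfl | hlt
      · obtain ⟨rfl, hξ⟩ := hc
        simpa using isWeakType_Hinf_one hξ
      · exact isWeakType_Hinf_of_lt hp hlt
    · exact isWeakType_Hinf_of_lt hp (h2 hc)

end
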